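/- Let k be a field and let G₀ and G₁ be groups such that every unit of the group algebra k[G₁] is trivial. Let Ψ : Rep_k(G₁) → Rep_k(G₀) be any functor between the categories of k-linear representations such that the composition of Ψ with the forgetful functor Rep_k(G₀) → Vect_k is naturally isomorphic to the forgetful functor Rep_k(G₁) → Vect_k. Then there exist a group homomorphism h : G₀ → G₁ and a group homomorphism κ : G₀ → kˣ such that for every representation ρ : G₁ → GL(V) of G₁ on a k-vector space V, the representation Ψ(ρ) is isomorphic in Rep_k(G₀) to the representation of G₀ on V given by g ↦ κ(g) · ρ(h(g)). -/

import Mathlib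

universe u

open CategoryTheory

namespace TannakaTwist

/-- The left regular representation on the group algebra. -/
noncomputable def regRep (k G : Type u) [Field k] [Group G] :
    Representation k G (MonoidAlgebra k G) :=
  ((Algebra.lmul k (MonoidAlgebra k G)) : _ →* Module.End k (MonoidAlgebra k G)).comp
    (MonoidAlgebra.of k G)

lemma regRep_asAlgebraHom (k G : Type u) [Field k] [Group G] (a b : MonoidAlgebra k G) :
    (regRep k G).asAlgebraHom a b = a * b := by
  have : (regRep k G).asAlgebraHom = Algebra.lmul k (MonoidAlgebra k G) := by
    refine MonoidAlgebra.algHom_ext ?_ (Subsingleton.elim _ _)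
    intro x
    rw [Representation.asAlgebraHom_single]
    simp [regRep]
  rw [this]
  simp

/-- The orbit map of a vector as an intertwining map from the regular representation. -/
noncomputable def orbitMap {k G V : Type u} [Field k] [Group G] [AddCommGroup V] [Module k V]
    (ρ : Representation k G V) (x : V) : (regRep k G).IntertwiningMap ρ where
  toLinearMap := (LinearMap.applyₗ x).comp ρ.asAlgebraHom.toLinearMap
  isIntertwining' g := by
    ext b
    simp [regRep]

lemma orbitMap_apply {k G V : Type u} [Field k] [Group G] [AddCommGroup V] [Module k V]
    (ρ : Representation k G V) (x : V) (a : MonoidAlgebra k G) :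
    orbitMap ρ x a = ρ.asAlgebraHom a x := rfl

section

variable {k G₀ G₁ : Type u} [Field k] [Group G₀] [Group G₁]
    {Ψ : Rep.{u} k G₁ ⥤ Rep.{u} k G₀}
    (α : Ψ ⋙ forget₂ (Rep.{u} k G₀) (ModuleCat.{u} k) ≅
      forget₂ (Rep.{u} k G₁) (ModuleCat.{u} k))

/-- The components of `α` as linear equivalences. -/
noncomputable def comp (A : Rep.{u} k G₁) : Ψ.obj A ≃ₗ[k] A := (α.app A).toLinearEquiv

lemma comp_nat {A B : Rep.{u} k G₁} (f : A ⟶ B) (x : Ψ.obj A) :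
    comp α B ((Ψ.map f).hom x) = f.hom (comp α A x) := by
  have := α.hom.naturality f
  exact LinearMap.congr_fun (congrArg ModuleCat.Hom.hom this) x

/-- The transported action. -/
noncomputable def act (A : Rep.{u} k G₁) (g : G₀) (x : A) : A :=
  comp α A ((Ψ.obj A).ρ g ((comp α A).symm x))

lemma act_nat {A B : Rep.{u} k G₁} (f : A ⟶ B) (g : G₀) (x : A) :
    act α B g (f.hom x) = f.hom (act α A g x) := by
  unfold act
  rw [← comp_nat, Rep.hom_comm_apply]
  congr 2
  rw [LinearEquiv.symm_apply_eq, comp_nat, LinearEquiv.apply_symm_apply]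

/-- The element of the group algebra attached to `g`. -/
noncomputable def elt (g : G₀) : MonoidAlgebra k G₁ :=
  act α (Rep.of (regRep k G₁)) g (1 : MonoidAlgebra k G₁)

lemma act_eq (A : Rep.{u} k G₁) (g : G₀) (x : A) :
    act α A g x = A.ρ.asAlgebraHom (elt α g) x := by
  have := act_nat α (A := Rep.of (regRep k G₁)) (B := A) (Rep.ofHom (orbitMap A.ρ x)) g
    (1 : MonoidAlgebra k G₁)
  have h1 : (Rep.ofHom (orbitMap A.ρ x)).hom (1 : MonoidAlgebra k G₁) = x := by
    rw [Rep.hom_ofHom, orbitMap_apply, map_one]; rfl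
  exact (congrArg (act α A g) h1).symm.trans this

lemma elt_one : elt α (1 : G₀) = 1 := by
  simp [elt, act]

lemma elt_mul (g h : G₀) : elt α (g * h) = elt α g * elt α h := by
  rw [← regRep_asAlgebraHom]
  refine Eq.trans ?_ (act_eq α (Rep.of (regRep k G₁)) g (elt α h))
  simp [elt, act]

/-- `elt` as a homomorphism into units. -/
noncomputable def eltHom : G₀ →* (MonoidAlgebra k G₁)ˣ :=
  MonoidHom.toHomUnits { toFun := elt α, map_one' := elt_one α, map_mul' := elt_mul α }

end

end TannakaTwist

/-- Let `k` be a field and `G₀`, `G₁` groups such that every unit of the group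
algebra `k[G₁]` is trivial. If `Ψ : Rep k G₁ ⥤ Rep k G₀` is a functor whose
composition with the forgetful functor to `k`-vector spaces is naturally
isomorphic to the forgetful functor on `Rep k G₁`, then there are group
homomorphisms `h : G₀ →* G₁` and `κ : G₀ →* kˣ` such that for every
representation `ρ` of `G₁`, the representation `Ψ.obj ρ` is isomorphic in
`Rep k G₀` to the representation of `G₀` on the same space given by
`g ↦ κ(g) • ρ(h(g))`. -/
theorem functor_eq_twisted_pullback_of_trivial_units
    (k G₀ G₁ : Type u) [Field k] [Group G₀] [Group G₁]
    (htriv : ∀ u : (MonoidAlgebra k G₁)ˣ, ∃ (c : kˣ) (g : G₁),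
      (u : MonoidAlgebra k G₁) = MonoidAlgebra.single g (c : k))
    (Ψ : Rep.{u} k G₁ ⥤ Rep.{u} k G₀)
    (hΨ : Nonempty (Ψ ⋙ forget₂ (Rep.{u} k G₀) (ModuleCat.{u} k) ≅
      forget₂ (Rep.{u} k G₁) (ModuleCat.{u} k))) :
    ∃ (h : G₀ →* G₁) (κ : G₀ →* kˣ), ∀ ρ : Rep.{u} k G₁,
      Nonempty (Ψ.obj ρ ≅ Rep.of (X := ρ)
        { toFun := fun g => (κ g : k) • (ρ.ρ (h g))
          map_one' := by simp
          map_mul' := fun a b => by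
            simp only [map_mul, Units.val_mul]
            exact (smul_mul_smul_comm _ _ _ _).symm }) := by
  obtain ⟨α⟩ := hΨ
  choose c d hcd using fun g : G₀ => htriv (TannakaTwist.eltHom α g)
  have helt : ∀ g, TannakaTwist.elt α g = MonoidAlgebra.single (d g) (c g : k) := hcd
  have inj : ∀ {a b : G₁} {x y : kˣ}, MonoidAlgebra.single a (x : k) =
      MonoidAlgebra.single b (y : k) → a = b ∧ x = y := by
    intro a b x y h
    have := MonoidAlgebra.single_inj.1 h
    simpa [Units.ext_iff] using this
  have h1 : d 1 = 1 ∧ c 1 = 1 := by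
    apply inj
    rw [← helt, TannakaTwist.elt_one]; rfl
  have hm : ∀ a b, d (a * b) = d a * d b ∧ c (a * b) = c a * c b := by
    intro a b
    apply inj
    rw [← helt, TannakaTwist.elt_mul, helt, helt, MonoidAlgebra.single_mul_single]; simp
  refine ⟨⟨⟨d, h1.1⟩, fun a b => (hm a b).1⟩, ⟨⟨c, h1.2⟩, fun a b => (hm a b).2⟩, fun ρ => ?_⟩
  refine ⟨Rep.mkIso (ρ := (Ψ.obj ρ).ρ) (.mk (TannakaTwist.comp α ρ) ?_)⟩
  intro g
  ext x
  have := TannakaTwist.act_eq α ρ g (TannakaTwist.comp α ρ x)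
  rw [helt, Representation.asAlgebraHom_single, TannakaTwist.act,
    LinearEquiv.symm_apply_apply] at this
  exact this
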